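/- On the complex vector space M_{m,n}(ℂ) of m×n complex matrices, the ternary commutator [A,B,C] = A Bᵀ C + ω·B Cᵀ A + ω̄·C Aᵀ B + C Bᵀ A + ω̄·B Aᵀ C + ω·A Cᵀ B satisfies, for all A₁,…,A₅ in M_{m,n}(ℂ), the basic identity: the sum, over the five cyclic shifts of the quintuple (A₁,A₂,A₃,A₄,A₅), of [[A₁,A₂,A₃],A₄,A₅] + [[A₁,A₄,A₂],A₅,A₃] + [[A₁,A₅,A₄],A₃,A₂] + [[A₁,A₃,A₅],A₂,A₄], equals zero. -/

import Mathlib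

open Matrix
/-- The primitive cube root of unity `ω = exp(2πi/3)`. -/
noncomputable def ω : ℂ := Complex.exp (2 * Real.pi * Complex.I / 3)

/-- Its complex conjugate `ω̄`. -/
noncomputable def ωb : ℂ := (starRingEnd ℂ) ω

/-- The ternary commutator on rectangular `m×n` complex matrices associated with the
ternary multiplication `A·B·C = A Bᵀ C`. -/
noncomputable def rectComm {m n : ℕ} (A B C : Matrix (Fin m) (Fin n) ℂ) :
    Matrix (Fin m) (Fin n) ℂ :=
  A * Bᵀ * C + ω • (B * Cᵀ * A) + ωb • (C * Aᵀ * B)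
    + C * Bᵀ * A + ωb • (B * Aᵀ * C) + ω • (A * Cᵀ * B)

/-- One group of four double ternary commutators in the basic identity. -/
noncomputable def rectBid {m n : ℕ} (A B C D F : Matrix (Fin m) (Fin n) ℂ) :
    Matrix (Fin m) (Fin n) ℂ :=
  rectComm (rectComm A B C) D F + rectComm (rectComm A D B) F C
    + rectComm (rectComm A F D) C B + rectComm (rectComm A C F) B D

/-- The alternating product `A Bᵀ C Dᵀ F`, the value of every bracketing of five factors in the
ternary multiplication `A Bᵀ C`. -/
noncomputable def quinaryProd {m n : ℕ} (A B C D F : Matrix (Fin m) (Fin n) ℂ) :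
    Matrix (Fin m) (Fin n) ℂ :=
  A * Bᵀ * C * Dᵀ * F

theorem omega_isPrimitiveRoot : IsPrimitiveRoot ω 3 := by
  simpa [ω] using Complex.isPrimitiveRoot_exp 3 three_ne_zero

theorem omegaBar_eq_sq : ωb = ω ^ 2 := by
  have h : ω⁻¹ = ωb := Complex.inv_eq_conj (omega_isPrimitiveRoot.norm'_eq_one three_ne_zero)
  rw [← h, inv_eq_of_mul_eq_one_right]
  rw [← pow_succ', omega_isPrimitiveRoot.pow_eq_one]

theorem omegaBar_eq : ωb = -1 - ω := by
  have h := omega_isPrimitiveRoot.geom_sum_eq_zero (by norm_num)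
  simp only [Finset.sum_range_succ, Finset.sum_range_zero] at h
  linear_combination omegaBar_eq_sq + h

theorem omega_mul_omega : ω * ω = ωb := by
  rw [omegaBar_eq_sq, sq]

theorem omega_mul_omegaBar : ω * ωb = 1 := by
  rw [omegaBar_eq_sq, ← pow_succ', omega_isPrimitiveRoot.pow_eq_one]

theorem omegaBar_mul_omegaBar : ωb * ωb = ω := by
  rw [← omega_mul_omega, mul_assoc, omega_mul_omega, omega_mul_omegaBar, mul_one]

theorem rectComm_rectComm {m n : ℕ} (A B C D F : Matrix (Fin m) (Fin n) ℂ) :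
    rectComm (rectComm A B C) D F = (
        quinaryProd A B C D F + quinaryProd C B A D F + quinaryProd D F C A B
          + quinaryProd D F B A C + quinaryProd F A C B D + quinaryProd F B C A D
          + quinaryProd F D A B C + quinaryProd F D C B A + quinaryProd D A C B F
          + quinaryProd D B C A F + quinaryProd C A B F D + quinaryProd B A C F D)
      + ω • (
        quinaryProd B C A D F + quinaryProd A C B D F + quinaryProd D F A B C
          + quinaryProd D F C B A + quinaryProd F B A C D + quinaryProd F C A B D
          + quinaryProd F D B C A + quinaryProd F D A C B + quinaryProd D B A C F
          + quinaryProd D C A B F + quinaryProd A B C F D + quinaryProd C B A F D)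
      + ωb • (
        quinaryProd C A B D F + quinaryProd B A C D F + quinaryProd D F B C A
          + quinaryProd D F A C B + quinaryProd F C B A D + quinaryProd F A B C D
          + quinaryProd F D C A B + quinaryProd F D B A C + quinaryProd D C B A F
          + quinaryProd D A B C F + quinaryProd B C A F D + quinaryProd A C B F D) := by
  simp only [rectComm, quinaryProd, transpose_add, transpose_smul, transpose_mul,
    transpose_transpose, Matrix.add_mul, Matrix.mul_add, Matrix.smul_mul, Matrix.mul_smul,
    smul_add, smul_smul, omega_mul_omega, omega_mul_omegaBar, mul_comm ωb ω,
    omegaBar_mul_omegaBar, one_smul, Matrix.mul_assoc]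
  abel

/-- the ternary commutator of rectangular matrices satisfies the basic
identity. -/
theorem rect_matrix_basic_identity {m n : ℕ}
    (A₁ A₂ A₃ A₄ A₅ : Matrix (Fin m) (Fin n) ℂ) :
    rectBid A₁ A₂ A₃ A₄ A₅ + rectBid A₂ A₃ A₄ A₅ A₁ + rectBid A₃ A₄ A₅ A₁ A₂
      + rectBid A₄ A₅ A₁ A₂ A₃ + rectBid A₅ A₁ A₂ A₃ A₄ = 0 := by
  simp only [rectBid, rectComm_rectComm, omegaBar_eq]
  module
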